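/- Let D, k, m be positive integers, A ⊆ ℂ^D an open connected set, Λ ⊆ ℂ an open set, and let M : A^{k+1} × Λ → Matrix (Fin m) (Fin m) ℂ be analytic, with M(u₀,…,u_k,λ) invertible everywhere. Suppose that for all i, j ∈ {1,…,D} one has ∂/∂u₀^i ( (∂/∂u_k^j M(u₀,…,u_k,λ)) * M(u₀,…,u_k,λ)⁻¹ ) = 0 on A^{k+1} × Λ. Fix a₀ ∈ A. Then the matrix-valued function N(u₀,u₁,…,u_k,λ) := M(a₀,u₁,…,u_k,λ)⁻¹ * M(u₀,u₁,…,u_k,λ) satisfies ∂/∂u_k^j N = 0 on A^{k+1} × Λ for all j ∈ {1,…,D}. -/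

import Mathlib

/-- The matrix of partial derivatives of the entries of a matrix-valued function
`F = F(u₀,…,u_k, λ)` with respect to the coordinate `u_ℓ^i`. -/
noncomputable def blockPDeriv (D k m : ℕ)
    (F : (Fin (k+1) → Fin D → ℂ) → ℂ → Matrix (Fin m) (Fin m) ℂ)
    (ℓ : Fin (k+1)) (i : Fin D)
    (u : Fin (k+1) → Fin D → ℂ) (lam : ℂ) : Matrix (Fin m) (Fin m) ℂ :=
  Matrix.of fun a b =>
    fderiv ℂ (fun p : (Fin (k+1) → Fin D → ℂ) × ℂ => F p.1 p.2 a b) (u, lam)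
      ((Pi.single ℓ (Pi.single i (1:ℂ)), (0:ℂ)))

/-- A determinant is differentiable where the entries of the matrix are. -/
theorem differentiableAt_matrix_det {𝕜 E n : Type*} [NontriviallyNormedField 𝕜]
    [NormedAddCommGroup E] [NormedSpace 𝕜 E] [Fintype n] [DecidableEq n]
    {F : E → Matrix n n 𝕜} {x : E}
    (hF : ∀ a b, DifferentiableAt 𝕜 (fun y => F y a b) x) :
    DifferentiableAt 𝕜 (fun y => (F y).det) x := by
  simp only [Matrix.det_apply']
  fun_prop

/-- The entries of the inverse matrix are differentiable where the entries of the matrix are and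
the matrix is invertible. -/
theorem differentiableAt_matrix_inv {𝕜 E n : Type*} [NontriviallyNormedField 𝕜]
    [NormedAddCommGroup E] [NormedSpace 𝕜 E] [Fintype n] [DecidableEq n]
    {F : E → Matrix n n 𝕜} {x : E}
    (hF : ∀ a b, DifferentiableAt 𝕜 (fun y => F y a b) x) (hx : IsUnit (F x)) (a b : n) :
    DifferentiableAt 𝕜 (fun y => (F y)⁻¹ a b) x := by
  have hdet : (F x).det ≠ 0 := ((Matrix.isUnit_iff_isUnit_det _).1 hx).ne_zero
  simp only [Matrix.inv_def, Ring.inverse_eq_inv', Matrix.smul_apply, smul_eq_mul,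
    Matrix.adjugate_apply]
  refine ((differentiableAt_matrix_det hF).inv hdet).mul (differentiableAt_matrix_det ?_)
  intro c d
  by_cases hc : c = b
  · subst hc
    simp
  · simpa [Matrix.updateRow_ne hc] using hF c d

/-- The entries of a product of matrices are differentiable where those of the factors are. -/
theorem differentiableAt_matrix_mul {𝕜 E n : Type*} [NontriviallyNormedField 𝕜]
    [NormedAddCommGroup E] [NormedSpace 𝕜 E] [Fintype n]
    {F G : E → Matrix n n 𝕜} {x : E}
    (hF : ∀ a b, DifferentiableAt 𝕜 (fun y => F y a b) x)
    (hG : ∀ a b, DifferentiableAt 𝕜 (fun y => G y a b) x) (a b : n) :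
    DifferentiableAt 𝕜 (fun y => (F y * G y) a b) x := by
  simp only [Matrix.mul_apply]
  fun_prop

/-- The product rule for matrix-valued functions, entry by entry. -/
theorem fderiv_matrix_mul_apply {𝕜 E n : Type*} [NontriviallyNormedField 𝕜]
    [NormedAddCommGroup E] [NormedSpace 𝕜 E] [Fintype n]
    {F G : E → Matrix n n 𝕜} {x : E}
    (hF : ∀ a b, DifferentiableAt 𝕜 (fun y => F y a b) x)
    (hG : ∀ a b, DifferentiableAt 𝕜 (fun y => G y a b) x) (v : E) (a b : n) :
    fderiv 𝕜 (fun y => (F y * G y) a b) x v =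
      (Matrix.of (fun c d => fderiv 𝕜 (fun y => F y c d) x v) * G x +
        F x * Matrix.of (fun c d => fderiv 𝕜 (fun y => G y c d) x v)) a b := by
  simp only [Matrix.mul_apply, Matrix.add_apply, Matrix.of_apply]
  rw [fderiv_fun_sum (A := fun i y => F y a i * G y i b) (fun i _ => (hF a i).mul (hG i b)), _root_.sum_apply,
    ← Finset.sum_add_distrib]
  refine Finset.sum_congr rfl fun i _ => ?_
  rw [fderiv_fun_mul (hF a i) (hG i b)]
  simp
  ring

/-- If `(∂F) F⁻¹ = (∂G) G⁻¹` at a point, then `∂(G⁻¹ F) = 0` there. -/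
theorem fderiv_matrix_inv_mul_eq_zero {𝕜 E n : Type*} [NontriviallyNormedField 𝕜]
    [NormedAddCommGroup E] [NormedSpace 𝕜 E] [Fintype n] [DecidableEq n]
    {F G : E → Matrix n n 𝕜} {x : E}
    (hF : ∀ a b, DifferentiableAt 𝕜 (fun y => F y a b) x)
    (hG : ∀ a b, DifferentiableAt 𝕜 (fun y => G y a b) x)
    (hFx : IsUnit (F x)) (hGu : ∀ᶠ y in nhds x, IsUnit (G y)) (v : E)
    (h : Matrix.of (fun c d => fderiv 𝕜 (fun y => F y c d) x v) * (F x)⁻¹ =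
      Matrix.of (fun c d => fderiv 𝕜 (fun y => G y c d) x v) * (G x)⁻¹) (a b : n) :
    fderiv 𝕜 (fun y => ((G y)⁻¹ * F y) a b) x v = 0 := by
  have hGx : IsUnit (G x) := hGu.self_of_nhds
  have hFdet := (Matrix.isUnit_iff_isUnit_det _).1 hFx
  have hGdet := (Matrix.isUnit_iff_isUnit_det _).1 hGx
  have hN := differentiableAt_matrix_mul (differentiableAt_matrix_inv hG hGx) hF
  have key : Matrix.of (fun c d => fderiv 𝕜 (fun y => F y c d) x v) =
      Matrix.of (fun c d => fderiv 𝕜 (fun y => G y c d) x v) * ((G x)⁻¹ * F x) +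
        G x * Matrix.of (fun c d => fderiv 𝕜 (fun y => ((G y)⁻¹ * F y) c d) x v) := by
    ext c d
    rw [← fderiv_matrix_mul_apply hG hN v c d, Matrix.of_apply]
    refine congrArg (fun L : E →L[𝕜] 𝕜 => L v) (Filter.EventuallyEq.fderiv_eq ?_)
    filter_upwards [hGu] with y hy
    rw [Matrix.mul_nonsing_inv_cancel_left _ _ ((Matrix.isUnit_iff_isUnit_det _).1 hy)]
  have hF' : Matrix.of (fun c d => fderiv 𝕜 (fun y => F y c d) x v) =
      Matrix.of (fun c d => fderiv 𝕜 (fun y => G y c d) x v) * ((G x)⁻¹ * F x) := by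
    rw [← Matrix.mul_assoc, ← h, Matrix.nonsing_inv_mul_cancel_right _ _ hFdet]
  have hzero : G x * Matrix.of (fun c d => fderiv 𝕜 (fun y => ((G y)⁻¹ * F y) c d) x v) = 0 := by
    rwa [← hF', left_eq_add] at key
  have := congrArg (fun X => ((G x)⁻¹ * X) a b) hzero
  simpa [Matrix.nonsing_inv_mul_cancel_left _ _ hGdet] using this

/-- Freezing one block of variables is differentiable. -/
theorem differentiable_update_prodMk {𝕜 ι V W : Type*} [NontriviallyNormedField 𝕜] [Fintype ι]
    [DecidableEq ι] [NormedAddCommGroup V] [NormedSpace 𝕜 V] [NormedAddCommGroup W]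
    [NormedSpace 𝕜 W] (i : ι) (c : V) :
    Differentiable 𝕜 (fun q : (ι → V) × W => (Function.update q.1 i c, q.2)) := by
  refine Differentiable.prodMk (differentiable_pi.2 fun l => ?_) differentiable_snd
  by_cases hl : l = i
  · subst hl
    simp
  · simp only [Function.update_of_ne hl]
    fun_prop

/-- Freezing one block of variables commutes with differentiating in another block. -/
theorem fderiv_comp_update_single {𝕜 ι V W X : Type*} [NontriviallyNormedField 𝕜] [Fintype ι]
    [DecidableEq ι] [NormedAddCommGroup V] [NormedSpace 𝕜 V] [NormedAddCommGroup W]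
    [NormedSpace 𝕜 W] [NormedAddCommGroup X] [NormedSpace 𝕜 X] {f : (ι → V) × W → X}
    {i l : ι} (hil : i ≠ l) (c e : V) (p : (ι → V) × W)
    (hf : DifferentiableAt 𝕜 f (Function.update p.1 i c, p.2)) :
    fderiv 𝕜 (fun q : (ι → V) × W => f (Function.update q.1 i c, q.2)) p (Pi.single l e, 0) =
      fderiv 𝕜 f (Function.update p.1 i c, p.2) (Pi.single l e, 0) := by
  have hg : DifferentiableAt 𝕜 (fun q : (ι → V) × W => f (Function.update q.1 i c, q.2)) p :=
    DifferentiableAt.comp (g := f) p hf (differentiable_update_prodMk i c p)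
  rw [← hg.lineDeriv_eq_fderiv, ← hf.lineDeriv_eq_fderiv, lineDeriv, lineDeriv]
  congr 1
  funext t
  congr 1
  refine Prod.ext ?_ rfl
  funext s
  by_cases hs : s = i
  · subst hs
    simp [Pi.single_eq_of_ne hil]
  · simp [Function.update_of_ne hs]

/-- A function on a product of blocks whose partial derivatives in the coordinates of the `i`-th
block vanish on a slice over a connected open set takes the same value along that slice. -/
theorem eq_update_of_fderiv_single_eq_zero {ι κ W : Type*} [Fintype ι] [DecidableEq ι]
    [Fintype κ] [DecidableEq κ] [NormedAddCommGroup W] [NormedSpace ℂ W]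
    {f : (ι → κ → ℂ) × W → ℂ} {A : Set (κ → ℂ)} (hA : IsOpen A) (hA' : IsPreconnected A)
    (i : ι) (p : (ι → κ → ℂ) × W)
    (hf : ∀ x ∈ A, DifferentiableAt ℂ f (Function.update p.1 i x, p.2))
    (hf' : ∀ x ∈ A, ∀ j,
      fderiv ℂ f (Function.update p.1 i x, p.2) (Pi.single i (Pi.single j 1), 0) = 0)
    (hp : p.1 i ∈ A) {a : κ → ℂ} (ha : a ∈ A) :
    f p = f (Function.update p.1 i a, p.2) := by
  have hd : ∀ x ∈ A, HasFDerivAt (fun y => f (Function.update p.1 i y, p.2))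
      (0 : (κ → ℂ) →L[ℂ] ℂ) x := by
    intro x hx
    have h := (hf x hx).hasFDerivAt.comp x
      ((hasFDerivAt_update (𝕜 := ℂ) p.1 x).prodMk (hasFDerivAt_const p.2 x))
    refine h.congr_fderiv
      (ContinuousLinearMap.coe_injective (LinearMap.pi_ext' fun j => LinearMap.ext_ring ?_))
    have hs : ContinuousLinearMap.pi (R := ℂ)
        (Pi.single i (ContinuousLinearMap.id ℂ (κ → ℂ)) : ι → (κ → ℂ) →L[ℂ] (κ → ℂ))
        (Pi.single j (1 : ℂ)) = (Pi.single i (Pi.single j 1) : ι → κ → ℂ) := by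
      funext s
      by_cases hs : s = i
      · subst hs
        simp
      · simp [Pi.single_eq_of_ne hs]
    exact (congrArg (fun e => fderiv ℂ f (Function.update p.1 i x, p.2) (e, (0 : W))) hs).trans
      (hf' x hx j)
  have := hA.is_const_of_fderiv_eq_zero (𝕜 := ℂ) hA'
    (fun x hx => (hd x hx).differentiableAt.differentiableWithinAt)
    (fun x hx => (hd x hx).fderiv) hp ha
  simpa using this

theorem simplification_eliminates_uk
    (D k m : ℕ) (hD : 0 < D) (hk : 0 < k) (hm : 0 < m)
    (A : Set (Fin D → ℂ)) (Λ : Set ℂ)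
    (hAopen : IsOpen A) (hAconn : IsConnected A) (hΛopen : IsOpen Λ)
    (M : (Fin (k+1) → Fin D → ℂ) → ℂ → Matrix (Fin m) (Fin m) ℂ)
    (S : Set ((Fin (k+1) → Fin D → ℂ) × ℂ))
    (hS : S = {p | (∀ ℓ : Fin (k+1), p.1 ℓ ∈ A) ∧ p.2 ∈ Λ})
    (hMan : ∀ a b : Fin m,
      AnalyticOnNhd ℂ (fun p : (Fin (k+1) → Fin D → ℂ) × ℂ => M p.1 p.2 a b) S)
    (hMinv : ∀ p ∈ S, IsUnit (M p.1 p.2))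
    (hflat : ∀ (i j : Fin D), ∀ p ∈ S, ∀ a b : Fin m,
      fderiv ℂ (fun q : (Fin (k+1) → Fin D → ℂ) × ℂ =>
          (blockPDeriv D k m M (Fin.last k) j q.1 q.2 * (M q.1 q.2)⁻¹) a b) p
        ((Pi.single (0 : Fin (k+1)) (Pi.single i (1:ℂ)), (0:ℂ))) = 0)
    (a₀ : Fin D → ℂ) (ha₀ : a₀ ∈ A) :
    ∀ (j : Fin D), ∀ p ∈ S, ∀ a b : Fin m,
      fderiv ℂ (fun q : (Fin (k+1) → Fin D → ℂ) × ℂ =>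
          ((M (Function.update q.1 0 a₀) q.2)⁻¹ * M q.1 q.2) a b) p
        ((Pi.single (Fin.last k) (Pi.single j (1:ℂ)), (0:ℂ))) = 0 := by
  have hmem : ∀ p, p ∈ S ↔ (∀ ℓ : Fin (k+1), p.1 ℓ ∈ A) ∧ p.2 ∈ Λ := fun p => by rw [hS]; rfl
  have hSopen : IsOpen S := by
    have : S = (Set.univ.pi fun _ => A) ×ˢ Λ := by
      ext p
      simp [hmem]
    rw [this]
    exact (isOpen_set_pi Set.finite_univ fun _ _ => hAopen).prod hΛopen
  have hupd : ∀ p ∈ S, ∀ x ∈ A, (Function.update p.1 0 x, p.2) ∈ S := by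
    intro p hp x hx
    rw [hmem] at hp ⊢
    refine ⟨fun ℓ => ?_, hp.2⟩
    by_cases hℓ : ℓ = 0
    · subst hℓ
      simpa using hx
    · simpa [Function.update_of_ne hℓ] using hp.1 ℓ
  have hlast : (0 : Fin (k+1)) ≠ Fin.last k := by
    simpa [Fin.ext_iff] using hk.ne
  have hMd : ∀ p ∈ S, ∀ a b, DifferentiableAt ℂ
      (fun q : (Fin (k+1) → Fin D → ℂ) × ℂ => M q.1 q.2 a b) p :=
    fun p hp a b => (hMan a b p hp).differentiableAt
  intro j p hp a b
  have hFd : ∀ p ∈ S, ∀ a b, DifferentiableAt ℂ (fun q : (Fin (k+1) → Fin D → ℂ) × ℂ =>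
      (blockPDeriv D k m M (Fin.last k) j q.1 q.2 * (M q.1 q.2)⁻¹) a b) p := by
    intro p hp
    refine differentiableAt_matrix_mul (fun c d => ?_)
      (differentiableAt_matrix_inv (hMd p hp) (hMinv p hp))
    exact ((hMan c d).fderiv p hp).differentiableAt.clm_apply (differentiableAt_const _)
  have hconst : blockPDeriv D k m M (Fin.last k) j p.1 p.2 * (M p.1 p.2)⁻¹ =
      blockPDeriv D k m M (Fin.last k) j (Function.update p.1 0 a₀) p.2 *
        (M (Function.update p.1 0 a₀) p.2)⁻¹ := by
    ext c d
    exact eq_update_of_fderiv_single_eq_zero (f := fun q : (Fin (k+1) → Fin D → ℂ) × ℂ =>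
      (blockPDeriv D k m M (Fin.last k) j q.1 q.2 * (M q.1 q.2)⁻¹) c d)
      hAopen hAconn.isPreconnected 0 p (fun x hx => hFd _ (hupd p hp x hx) c d)
      (fun x hx i => hflat i j _ (hupd p hp x hx) c d) (((hmem p).1 hp).1 0) ha₀
  have hp₀ := hupd p hp a₀ ha₀
  refine fderiv_matrix_inv_mul_eq_zero (F := fun q : (Fin (k+1) → Fin D → ℂ) × ℂ => M q.1 q.2)
    (G := fun q => M (Function.update q.1 0 a₀) q.2) (hMd p hp) (fun c d => ?_) (hMinv p hp)
    ?_ _ ?_ a b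
  · exact DifferentiableAt.comp (𝕜 := ℂ) (g := fun q : (Fin (k+1) → Fin D → ℂ) × ℂ => M q.1 q.2 c d)
      p (hMd _ hp₀ c d) (differentiable_update_prodMk (𝕜 := ℂ) 0 a₀ p)
  · filter_upwards [hSopen.mem_nhds hp] with q hq
    exact hMinv _ (hupd q hq a₀ ha₀)
  · refine hconst.trans (congrArg (· * (M (Function.update p.1 0 a₀) p.2)⁻¹) ?_)
    ext c d
    exact (fderiv_comp_update_single hlast a₀ (Pi.single j 1) p (hMd _ hp₀ c d)).symm
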